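/- arXiv:2001.04862 — 3 statements merged into one kernel-verified Lean document; each statement's English description precedes it below -/
import Mathlib

section
/- For every positive integer n there exists a function G : ℤ × ℤ → ℝ such that G(v) = 0 for every v ∈ ℤ² with |v| > n, (ΔG)(0,0) = 1, and (ΔG)(v) = 0 for every v ∈ ℤ² with |v| ≤ n and v ≠ (0,0). -/
noncomputable section

/-- Discrete Laplacian on the nearest-neighbor graph of `ℤ²`. -/
def lapZ (f : ℤ × ℤ → ℝ) (v : ℤ × ℤ) : ℝ :=
  4 * f v - (f (v.1 + 1, v.2) + f (v.1 - 1, v.2) + f (v.1, v.2 + 1) + f (v.1, v.2 - 1))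

/-- Euclidean norm of a point of `ℤ²`. -/
def znorm (v : ℤ × ℤ) : ℝ := Real.sqrt ((v.1 : ℝ) ^ 2 + (v.2 : ℝ) ^ 2)

/-- Maximum principle: a function vanishing off a finite set and subharmonic on it is nonpositive. -/
theorem nonpos_of_lapZ_nonpos {S : Set (ℤ × ℤ)} (hS : S.Finite) {f : ℤ × ℤ → ℝ}
    (hf : ∀ v ∉ S, f v = 0) (hl : ∀ v ∈ S, lapZ f v ≤ 0) (v : ℤ × ℤ) : f v ≤ 0 := by
  by_contra! hv
  have hvS : v ∈ S := by
    by_contra h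
    exact hv.ne' (hf v h)
  obtain ⟨w, hwS, hw⟩ := hS.exists_maximalFor (fun u => toLex (f u, u.1)) S ⟨v, hvS⟩
  have key : ∀ u ∈ S, f u < f w ∨ f u = f w ∧ u.1 ≤ w.1 := fun u hu => by
    have h : toLex (f u, u.1) ≤ toLex (f w, w.1) :=
      (le_total _ _).elim id fun h => hw hu h
    simpa [Prod.Lex.toLex_le_toLex] using h
  have hw0 : 0 < f w := by
    rcases key v hvS with h | h <;> linarith [h]
  have hle : ∀ u, f u ≤ f w := fun u => by
    by_cases hu : u ∈ S
    · rcases key u hu with h | h <;> linarith [h]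
    · rw [hf u hu]; exact hw0.le
  have hlt : f (w.1 + 1, w.2) < f w := by
    by_cases hu : (w.1 + 1, w.2) ∈ S
    · rcases key _ hu with h | ⟨-, h⟩
      · exact h
      · simp at h
    · rw [hf _ hu]; exact hw0
  have h := hl w hwS
  unfold lapZ at h
  linarith [hle (w.1 - 1, w.2), hle (w.1, w.2 + 1), hle (w.1, w.2 - 1)]

/-- The Dirichlet problem for `lapZ` on a finite set is solvable. -/
theorem exists_lapZ_eq {S : Set (ℤ × ℤ)} (hS : S.Finite) (g : ℤ × ℤ → ℝ) :
    ∃ G : ℤ × ℤ → ℝ, (∀ v ∉ S, G v = 0) ∧ ∀ v ∈ S, lapZ G v = g v := by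
  classical
  have := hS.to_subtype
  let e : (S → ℝ) → ℤ × ℤ → ℝ := fun f v => if h : v ∈ S then f ⟨v, h⟩ else 0
  have e_add (f₁ f₂ : S → ℝ) (v) : e (f₁ + f₂) v = e f₁ v + e f₂ v := by
    by_cases h : v ∈ S <;> simp [e, h]
  have e_smul (c : ℝ) (f : S → ℝ) (v) : e (c • f) v = c * e f v := by
    by_cases h : v ∈ S <;> simp [e, h]
  let T : (S → ℝ) →ₗ[ℝ] (S → ℝ) :=
    { toFun := fun f v => lapZ (e f) v
      map_add' := fun f₁ f₂ => by
        ext v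
        simp only [lapZ, e_add, Pi.add_apply]
        ring
      map_smul' := fun c f => by
        ext v
        simp only [lapZ, e_smul, Pi.smul_apply, smul_eq_mul, RingHom.id_apply]
        ring }
  have e_off (f : S → ℝ) : ∀ v ∉ S, e f v = 0 := fun v hv => by simp [e, hv]
  have nonpos (f : S → ℝ) (hf : T f = 0) (v : S) : f v ≤ 0 := by
    have h := nonpos_of_lapZ_nonpos hS (e_off f) (fun u hu => (congrFun hf ⟨u, hu⟩).le) v
    simpa [e] using h
  have inj : Function.Injective T := by
    refine (injective_iff_map_eq_zero T).2 fun f hf => funext fun v => ?_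
    refine le_antisymm (nonpos f hf v) ?_
    simpa using nonpos (-f) (by rw [map_neg, hf, neg_zero]) v
  obtain ⟨f, hf⟩ := LinearMap.injective_iff_surjective.1 inj fun v => g v
  exact ⟨e f, e_off f, fun v hv => congrFun hf ⟨v, hv⟩⟩

theorem finite_znorm_le (n : ℕ) : {v : ℤ × ℤ | znorm v ≤ n}.Finite := by
  refine (Set.finite_Icc ((-n, -n) : ℤ × ℤ) (n, n)).subset fun v hv => ?_
  have h : (v.1 : ℝ) ^ 2 + (v.2 : ℝ) ^ 2 ≤ (n : ℝ) ^ 2 :=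
    (Real.sqrt_le_left n.cast_nonneg).1 hv
  have h' : v.1 ^ 2 + v.2 ^ 2 ≤ (n : ℤ) ^ 2 := by exact_mod_cast h
  have h₁ := abs_le_of_sq_le_sq' (a := v.1) (b := n) (by nlinarith) (by positivity)
  have h₂ := abs_le_of_sq_le_sq' (a := v.2) (b := n) (by nlinarith) (by positivity)
  exact ⟨⟨h₁.1, h₂.1⟩, h₁.2, h₂.2⟩

/-- For every positive integer `n` there exists a Green function of the ball `B(n)`. -/
theorem exists_green_function (n : ℕ) (hn : 0 < n) :
    ∃ G : ℤ × ℤ → ℝ,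
      (∀ v : ℤ × ℤ, (n : ℝ) < znorm v → G v = 0) ∧
      lapZ G (0, 0) = 1 ∧
      (∀ v : ℤ × ℤ, znorm v ≤ (n : ℝ) → v ≠ (0, 0) → lapZ G v = 0) := by
  obtain ⟨G, hG, hlap⟩ := exists_lapZ_eq (finite_znorm_le n) (Pi.single (0, 0) 1)
  refine ⟨G, fun v hv => hG v (not_le.2 hv), ?_, fun v hv h0 => ?_⟩
  · simpa using hlap (0, 0) (by simp [znorm])
  · rw [hlap v hv, Pi.single_eq_of_ne h0]
end
end

section
/- Let g₁, g₂ : ℤ × ℤ → ℝ both satisfy: g(0,0) = 0, (Δg)(0,0) = 1, (Δg)(v) = 0 for every v ≠ (0,0), and there exists a constant C > 0 such that |g(v)| ≤ C·(1 + log(1 + |v|)) for every v ∈ ℤ². Then g₁ = g₂. -/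
noncomputable section

/-- The Laplacian is invariant under translations. -/
theorem lapZ_translate (f : ℤ × ℤ → ℝ) (d v : ℤ × ℤ) :
    lapZ (fun w => f (w + d)) v = lapZ f (v + d) := by
  simp only [lapZ, Prod.add_def]
  ring_nf

theorem lapZ_sub (f g : ℤ × ℤ → ℝ) (v : ℤ × ℤ) :
    lapZ (fun w => f w - g w) v = lapZ f v - lapZ g v := by
  simp only [lapZ]
  ring

/-- The sum of the squared differences of `f` along the four edges at `v`. -/
def gradSq (f : ℤ × ℤ → ℝ) (v : ℤ × ℤ) : ℝ :=
  (f (v + (1, 0)) - f v) ^ 2 + (f (v + (-1, 0)) - f v) ^ 2 +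
    (f (v + (0, 1)) - f v) ^ 2 + (f (v + (0, -1)) - f v) ^ 2

theorem gradSq_nonneg (f : ℤ × ℤ → ℝ) (v : ℤ × ℤ) : 0 ≤ gradSq f v := by
  unfold gradSq
  positivity

/-- For a function harmonic at `v`, the Laplacian of its square is minus its squared gradient. -/
theorem lapZ_sq_of_harmonic {f : ℤ × ℤ → ℝ} {v : ℤ × ℤ} (hf : lapZ f v = 0) :
    lapZ (fun w => f w ^ 2) v = -gradSq f v := by
  simp only [lapZ] at hf
  simp only [lapZ, gradSq, Prod.add_def, add_zero, ← sub_eq_add_neg]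
  linear_combination (2 * f v) * hf

/-- The squared gradient of a harmonic function is subharmonic. -/
theorem lapZ_gradSq_nonpos {f : ℤ × ℤ → ℝ} (hf : ∀ v, lapZ f v = 0) (v : ℤ × ℤ) :
    lapZ (gradSq f) v ≤ 0 := by
  have key (d : ℤ × ℤ) : lapZ (fun w => (f (w + d) - f w) ^ 2) v ≤ 0 := by
    have harm : lapZ (fun w => f (w + d) - f w) v = 0 := by
      rw [lapZ_sub (fun w => f (w + d)) f, lapZ_translate, hf, hf, sub_zero]
    rw [lapZ_sq_of_harmonic harm]
    exact neg_nonpos.2 (gradSq_nonneg _ _)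
  have h₁ := key (1, 0)
  have h₂ := key (-1, 0)
  have h₃ := key (0, 1)
  have h₄ := key (0, -1)
  simp only [lapZ, gradSq] at *
  linarith

/-- If a harmonic function satisfies `f ^ 2 ≤ M` on the `ℓ¹`-ball of radius `n` about `v`, then
`f v ^ 2 + n / 4 * gradSq f v ≤ M`. -/
theorem sq_add_mul_gradSq_le {f : ℤ × ℤ → ℝ} (hf : ∀ v, lapZ f v = 0) (M : ℝ) (n : ℕ) :
    ∀ v : ℤ × ℤ, (∀ w : ℤ × ℤ, |w.1 - v.1| + |w.2 - v.2| ≤ n → f w ^ 2 ≤ M) →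
      f v ^ 2 + n / 4 * gradSq f v ≤ M := by
  induction n with
  | zero =>
    intro v h
    simpa using h v (by simp)
  | succ n ih =>
    intro v h
    have step (a b : ℤ) (hab : |a - v.1| + |b - v.2| ≤ 1) :
        f (a, b) ^ 2 + n / 4 * gradSq f (a, b) ≤ M := by
      refine ih (a, b) fun w hw => h w ?_
      have h₁ := abs_sub_le w.1 a v.1
      have h₂ := abs_sub_le w.2 b v.2
      push_cast
      simp only at hw
      linarith
    have e₁ := step (v.1 + 1) v.2 (by simp)
    have e₂ := step (v.1 - 1) v.2 (by simp)
    have e₃ := step v.1 (v.2 + 1) (by simp)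
    have e₄ := step v.1 (v.2 - 1) (by simp)
    have hsq := lapZ_sq_of_harmonic (hf v)
    have hgrad := mul_nonpos_of_nonneg_of_nonpos (Nat.cast_nonneg (α := ℝ) n)
      (lapZ_gradSq_nonpos hf v)
    simp only [lapZ] at hsq hgrad
    push_cast
    linarith

theorem znorm_le_abs_add_abs (v : ℤ × ℤ) : znorm v ≤ |(v.1 : ℝ)| + |(v.2 : ℝ)| := by
  refine Real.sqrt_le_iff.2 ⟨by positivity, ?_⟩
  nlinarith [sq_abs (v.1 : ℝ), sq_abs (v.2 : ℝ),
    mul_nonneg (abs_nonneg (v.1 : ℝ)) (abs_nonneg (v.2 : ℝ))]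

theorem znorm_nonneg (v : ℤ × ℤ) : 0 ≤ znorm v := Real.sqrt_nonneg _

/-- The squared logarithm is sublinear. -/
theorem tendsto_sq_one_add_log_div_atTop (C K : ℝ) :
    Filter.Tendsto (fun n : ℕ => (C * (1 + Real.log (K + n))) ^ 2 / (K + n))
      Filter.atTop (nhds 0) := by
  have hpow (k : ℕ) : Filter.Tendsto (fun x : ℝ => Real.log x ^ k / x) Filter.atTop (nhds 0) := by
    simpa using Real.tendsto_pow_log_div_mul_add_atTop 1 0 k one_ne_zero
  have hlim : Filter.Tendsto (fun x : ℝ => (C * (1 + Real.log x)) ^ 2 / x)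
      Filter.atTop (nhds 0) := by
    have := (((hpow 0).add ((hpow 1).const_mul 2)).add (hpow 2)).const_mul (C ^ 2)
    simp only [mul_zero, add_zero] at this
    refine this.congr fun x => ?_
    ring
  exact hlim.comp (Filter.tendsto_atTop_add_const_left _ K tendsto_natCast_atTop_atTop)

/-- A harmonic function of logarithmic growth has zero gradient. -/
theorem gradSq_eq_zero_of_log_growth {f : ℤ × ℤ → ℝ} (hf : ∀ v, lapZ f v = 0) {C : ℝ}
    (hC : 0 ≤ C) (hbdd : ∀ v, |f v| ≤ C * (1 + Real.log (1 + znorm v))) (v : ℤ × ℤ) :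
    gradSq f v = 0 := by
  set K : ℝ := 1 + |(v.1 : ℝ)| + |(v.2 : ℝ)| with hK
  have hK1 : 1 ≤ K := by
    rw [hK, add_assoc]
    exact le_add_of_nonneg_right (by positivity)
  have bound (n : ℕ) : n / 4 * gradSq f v ≤ (C * (1 + Real.log (K + n))) ^ 2 := by
    have := sq_add_mul_gradSq_le hf ((C * (1 + Real.log (K + n))) ^ 2) n v fun w hw => by
      have hw' : |(w.1 : ℝ) - v.1| + |(w.2 : ℝ) - v.2| ≤ n := by exact_mod_cast hw
      have h₁ := abs_add_le ((w.1 : ℝ) - v.1) v.1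
      have h₂ := abs_add_le ((w.2 : ℝ) - v.2) v.2
      rw [sub_add_cancel] at h₁ h₂
      have hz : 1 + znorm w ≤ K + n := by linarith [znorm_le_abs_add_abs w]
      have hpos : 0 < 1 + znorm w := by linarith [znorm_nonneg w]
      rw [← sq_abs]
      refine pow_le_pow_left₀ (abs_nonneg _) ((hbdd w).trans ?_) 2
      gcongr
    linarith [sq_nonneg (f v)]
  have hlim : Filter.Tendsto (fun n : ℕ => (n : ℝ) / (K + n) * (gradSq f v / 4))
      Filter.atTop (nhds (1 * (gradSq f v / 4))) := by
    refine Filter.Tendsto.mul_const _ ?_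
    simpa [add_comm] using tendsto_natCast_div_add_atTop K
  have hle := le_of_tendsto_of_tendsto' hlim (tendsto_sq_one_add_log_div_atTop C K) fun n => by
    have hpos : 0 < K + n := by positivity
    calc (n : ℝ) / (K + n) * (gradSq f v / 4) = n / 4 * gradSq f v / (K + n) := by ring
      _ ≤ _ := by gcongr; exact bound n
  linarith [gradSq_nonneg f v]

/-- A function on `ℤ²` with zero gradient is constant. -/
theorem eq_apply_zero_of_gradSq_eq_zero {f : ℤ × ℤ → ℝ} (hf : ∀ v, gradSq f v = 0)
    (v : ℤ × ℤ) : f v = f (0, 0) := by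
  have right (a b : ℤ) : f (a + 1, b) = f (a, b) := by
    have h := hf (a, b)
    simp only [gradSq, Prod.mk_add_mk, add_zero] at h
    exact sub_eq_zero.1 (pow_eq_zero_iff two_ne_zero |>.1 (le_antisymm (by
      nlinarith [sq_nonneg (f (a + -1, b) - f (a, b)), sq_nonneg (f (a, b + 1) - f (a, b)),
        sq_nonneg (f (a, b + -1) - f (a, b))]) (sq_nonneg _)))
  have up (a b : ℤ) : f (a, b + 1) = f (a, b) := by
    have h := hf (a, b)
    simp only [gradSq, Prod.mk_add_mk, add_zero] at h
    exact sub_eq_zero.1 (pow_eq_zero_iff two_ne_zero |>.1 (le_antisymm (by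
      nlinarith [sq_nonneg (f (a + -1, b) - f (a, b)), sq_nonneg (f (a + 1, b) - f (a, b)),
        sq_nonneg (f (a, b + -1) - f (a, b))]) (sq_nonneg _)))
  have hor : Function.Periodic (fun a : ℤ => f (a, v.2)) 1 := fun a => right a v.2
  have ver : Function.Periodic (fun b : ℤ => f (0, b)) 1 := fun b => up 0 b
  have h₁ := hor.int_mul_eq v.1
  have h₂ := ver.int_mul_eq v.2
  simp only [Int.cast_id, mul_one] at h₁ h₂
  exact h₁.trans h₂

/-- Uniqueness of the full-plane Green function with logarithmic growth. -/
theorem fullplane_green_function_unique (g₁ g₂ : ℤ × ℤ → ℝ)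
    (h₁zero : g₁ (0, 0) = 0) (h₁lap : lapZ g₁ (0, 0) = 1)
    (h₁harm : ∀ v : ℤ × ℤ, v ≠ (0, 0) → lapZ g₁ v = 0)
    (h₁bdd : ∃ C : ℝ, 0 < C ∧ ∀ v : ℤ × ℤ, |g₁ v| ≤ C * (1 + Real.log (1 + znorm v)))
    (h₂zero : g₂ (0, 0) = 0) (h₂lap : lapZ g₂ (0, 0) = 1)
    (h₂harm : ∀ v : ℤ × ℤ, v ≠ (0, 0) → lapZ g₂ v = 0)
    (h₂bdd : ∃ C : ℝ, 0 < C ∧ ∀ v : ℤ × ℤ, |g₂ v| ≤ C * (1 + Real.log (1 + znorm v))) :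
    g₁ = g₂ := by
  obtain ⟨C₁, hC₁, hb₁⟩ := h₁bdd
  obtain ⟨C₂, hC₂, hb₂⟩ := h₂bdd
  have harm (v : ℤ × ℤ) : lapZ (fun w => g₁ w - g₂ w) v = 0 := by
    rw [lapZ_sub]
    by_cases hv : v = (0, 0)
    · rw [hv, h₁lap, h₂lap, sub_self]
    · rw [h₁harm v hv, h₂harm v hv, sub_self]
  have hbdd (v : ℤ × ℤ) : |g₁ v - g₂ v| ≤ (C₁ + C₂) * (1 + Real.log (1 + znorm v)) := by
    rw [add_mul]
    exact (abs_sub _ _).trans (add_le_add (hb₁ v) (hb₂ v))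
  funext v
  have h := eq_apply_zero_of_gradSq_eq_zero
    (gradSq_eq_zero_of_log_growth harm (add_pos hC₁ hC₂).le hbdd) v
  simp only [h₁zero, h₂zero, sub_self] at h
  exact sub_eq_zero.1 h
end
end

section
/- There exists a constant C > 0 such that for every positive integer n and every Green function G of the ball B(n), one has Σ_{v ∈ ℤ²} G(v)² ≤ C·n². -/
noncomputable section

/-- `G` is a Green function of the ball `B(n) = {v : |v| ≤ n}`. -/
def IsGreen (n : ℕ) (G : ℤ × ℤ → ℝ) : Prop :=
  (∀ v : ℤ × ℤ, (n : ℝ) < znorm v → G v = 0) ∧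
  lapZ G (0, 0) = 1 ∧
  (∀ v : ℤ × ℤ, znorm v ≤ (n : ℝ) → v ≠ (0, 0) → lapZ G v = 0)

/-- The membership `v ∈ B(n)` in integer terms. -/
lemma znorm_le_natCast_iff (n : ℕ) (v : ℤ × ℤ) :
    znorm v ≤ (n : ℝ) ↔ v.1 ^ 2 + v.2 ^ 2 ≤ (n : ℤ) ^ 2 := by
  rw [znorm, Real.sqrt_le_left (Nat.cast_nonneg n)]
  exact_mod_cast Iff.rfl

/-- Minimum principle: a function that is strictly superharmonic on a finite set and nonnegative
at the neighbors outside this set is nonnegative on the set. -/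
lemma nonneg_of_lapZ_pos {B : Finset (ℤ × ℤ)} {F : ℤ × ℤ → ℝ}
    (hlap : ∀ v ∈ B, 0 < lapZ F v)
    (hbd : ∀ v ∈ B, ∀ w ∈ [(v.1 + 1, v.2), (v.1 - 1, v.2), (v.1, v.2 + 1), (v.1, v.2 - 1)],
      w ∉ B → 0 ≤ F w) :
    ∀ v ∈ B, 0 ≤ F v := by
  intro v hv
  obtain ⟨u, hu, hmin⟩ := B.exists_min_image F ⟨v, hv⟩
  refine le_trans ?_ (hmin v hv)
  by_contra! hneg
  have key : ∀ w ∈ [(u.1 + 1, u.2), (u.1 - 1, u.2), (u.1, u.2 + 1), (u.1, u.2 - 1)],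
      F u ≤ F w := by
    intro w hw
    by_cases hwB : w ∈ B
    · exact hmin w hwB
    · exact hneg.le.trans (hbd u hu w hw hwB)
  have hl := hlap u hu
  simp only [List.mem_cons, List.not_mem_nil, or_false, forall_eq_or_imp, forall_eq] at key
  obtain ⟨h1, h2, h3, h4⟩ := key
  unfold lapZ at hl
  linarith

/-- The barrier `log (2n² + 3) - log (|v|² + 1)`, strictly superharmonic on `ℤ²`. -/
def logBarrier (n : ℕ) (v : ℤ × ℤ) : ℝ :=
  Real.log (2 * (n : ℝ) ^ 2 + 3) - Real.log ((v.1 : ℝ) ^ 2 + (v.2 : ℝ) ^ 2 + 1)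

lemma lapZ_logBarrier_pos (n : ℕ) (v : ℤ × ℤ) : 0 < lapZ (logBarrier n) v := by
  obtain ⟨a, b⟩ := v
  simp only [lapZ, logBarrier]
  push_cast
  generalize (a : ℝ) = x
  generalize (b : ℝ) = y
  have hs : 0 < x ^ 2 + y ^ 2 + 1 := by positivity
  have h1 : 0 < (x + 1) ^ 2 + y ^ 2 + 1 := by positivity
  have h2 : 0 < (x - 1) ^ 2 + y ^ 2 + 1 := by positivity
  have h3 : 0 < x ^ 2 + (y + 1) ^ 2 + 1 := by positivity
  have h4 : 0 < x ^ 2 + (y - 1) ^ 2 + 1 := by positivity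
  have hlt : (x ^ 2 + y ^ 2 + 1) ^ 4 < ((x + 1) ^ 2 + y ^ 2 + 1) * ((x - 1) ^ 2 + y ^ 2 + 1) *
      (x ^ 2 + (y + 1) ^ 2 + 1) * (x ^ 2 + (y - 1) ^ 2 + 1) := by
    have hid : ((x + 1) ^ 2 + y ^ 2 + 1) * ((x - 1) ^ 2 + y ^ 2 + 1) *
        (x ^ 2 + (y + 1) ^ 2 + 1) * (x ^ 2 + (y - 1) ^ 2 + 1) - (x ^ 2 + y ^ 2 + 1) ^ 4 =
        2 * (x ^ 2 + y ^ 2 + 1) ^ 2 + 8 * (x ^ 2 + y ^ 2 + 1) + 5 + 16 * x ^ 2 * y ^ 2 := by ring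
    have : 0 < 2 * (x ^ 2 + y ^ 2 + 1) ^ 2 + 8 * (x ^ 2 + y ^ 2 + 1) + 5 + 16 * x ^ 2 * y ^ 2 := by
      positivity
    linarith
  have hlog := Real.log_lt_log (by positivity) hlt
  rw [Real.log_pow, Real.log_mul (by positivity) h4.ne', Real.log_mul (by positivity) h3.ne',
    Real.log_mul h1.ne' h2.ne'] at hlog
  push_cast at hlog
  linarith

lemma one_lt_lapZ_logBarrier_zero (n : ℕ) : 1 < lapZ (logBarrier n) (0, 0) := by
  have := Real.log_two_gt_d9
  norm_num [lapZ, logBarrier]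
  linarith

lemma logBarrier_nonneg {n : ℕ} {v : ℤ × ℤ}
    (hv : (v.1 : ℝ) ^ 2 + (v.2 : ℝ) ^ 2 ≤ 2 * (n : ℝ) ^ 2 + 2) : 0 ≤ logBarrier n v :=
  sub_nonneg.2 (Real.log_le_log (by positivity) (by linarith))

lemma lapZ_logBarrier_add_smul (n : ℕ) (G : ℤ × ℤ → ℝ) (c : ℝ) (v : ℤ × ℤ) :
    lapZ (fun w => logBarrier n w + c * G w) v = lapZ (logBarrier n) v + c * lapZ G v := by
  simp only [lapZ]
  ring

/-- The finite square containing `B(n)`. -/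
def intBox (n : ℕ) : Finset (ℤ × ℤ) := Finset.Icc (-(n : ℤ)) n ×ˢ Finset.Icc (-(n : ℤ)) n

lemma mem_intBox_of_znorm_le {n : ℕ} {v : ℤ × ℤ} (hv : znorm v ≤ n) : v ∈ intBox n := by
  rw [znorm_le_natCast_iff] at hv
  have h1 := abs_le_of_sq_le_sq (a := v.1) (b := n) (by nlinarith [sq_nonneg v.2]) (by positivity)
  have h2 := abs_le_of_sq_le_sq (a := v.2) (b := n) (by nlinarith [sq_nonneg v.1]) (by positivity)
  simp only [intBox, Finset.mem_product, Finset.mem_Icc]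
  exact ⟨abs_le.1 h1, abs_le.1 h2⟩

/-- Comparison of a multiple `-c * G` of a Green function with the logarithmic barrier. -/
lemma IsGreen.logBarrier_add_nonneg {n : ℕ} {G : ℤ × ℤ → ℝ} (hG : IsGreen n G) {c : ℝ}
    (hc : -1 ≤ c) {v : ℤ × ℤ} (hv : znorm v ≤ n) : 0 ≤ logBarrier n v + c * G v := by
  classical
  obtain ⟨hout, hzero, hharm⟩ := hG
  have hmem : ∀ w, w ∈ (intBox n).filter (fun w => znorm w ≤ n) ↔ znorm w ≤ n := fun w => by
    rw [Finset.mem_filter, and_iff_right_iff_imp]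
    exact mem_intBox_of_znorm_le
  refine nonneg_of_lapZ_pos (F := fun w => logBarrier n w + c * G w) ?_ ?_ v ((hmem v).2 hv)
  · intro w hw
    rw [hmem] at hw
    rw [lapZ_logBarrier_add_smul]
    by_cases hw0 : w = (0, 0)
    · rw [hw0, hzero]
      linarith [one_lt_lapZ_logBarrier_zero n]
    · rw [hharm w hw hw0, mul_zero, add_zero]
      exact lapZ_logBarrier_pos n w
  · intro w hw u hu huB
    rw [hmem, znorm_le_natCast_iff] at hw
    rw [hmem, not_le] at huB
    have hw' : (w.1 : ℝ) ^ 2 + (w.2 : ℝ) ^ 2 ≤ (n : ℝ) ^ 2 := by exact_mod_cast hw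
    simp only [hout u huB, mul_zero, add_zero]
    apply logBarrier_nonneg
    simp only [List.mem_cons, List.not_mem_nil, or_false] at hu
    rcases hu with rfl | rfl | rfl | rfl <;> push_cast <;>
      nlinarith [sq_nonneg ((w.1 : ℝ) - 1), sq_nonneg ((w.1 : ℝ) + 1), sq_nonneg ((w.2 : ℝ) - 1),
        sq_nonneg ((w.2 : ℝ) + 1), sq_nonneg (w.1 : ℝ), sq_nonneg (w.2 : ℝ)]

lemma IsGreen.sq_le_logBarrier_sq {n : ℕ} {G : ℤ × ℤ → ℝ} (hG : IsGreen n G) {v : ℤ × ℤ}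
    (hv : znorm v ≤ n) : G v ^ 2 ≤ logBarrier n v ^ 2 := by
  have h1 := hG.logBarrier_add_nonneg (c := 1) (by norm_num) hv
  have h2 := hG.logBarrier_add_nonneg (c := -1) le_rfl hv
  exact sq_le_sq' (by linarith) (by linarith)

lemma log_sq_le_mul_sqrt {t : ℝ} (ht : 1 ≤ t) : Real.log t ^ 2 ≤ 16 * √t := by
  have h0 : 0 < √(√t) := by positivity
  have hlog : Real.log t = 4 * Real.log √(√t) := by
    rw [Real.log_sqrt (by positivity), Real.log_sqrt (by positivity)]
    ring
  have h1 : Real.log √(√t) ≤ √(√t) := (Real.log_le_sub_one_of_pos h0).trans (by linarith)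
  have h2 : 0 ≤ Real.log t := Real.log_nonneg ht
  have h3 : √(√t) ^ 2 = √t := Real.sq_sqrt (Real.sqrt_nonneg t)
  nlinarith

/-- The square of the barrier is dominated on `B(n)` by a product function. -/
lemma logBarrier_sq_le {n : ℕ} (hn : 0 < n) {v : ℤ × ℤ} (hv : znorm v ≤ n) :
    logBarrier n v ^ 2 ≤ 64 * n * (1 / √(|(v.1 : ℝ)| + 1) * (1 / √(|(v.2 : ℝ)| + 1))) := by
  have hn' : (1 : ℝ) ≤ n := by exact_mod_cast hn
  have hv' : (v.1 : ℝ) ^ 2 + (v.2 : ℝ) ^ 2 ≤ (n : ℝ) ^ 2 := by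
    exact_mod_cast (znorm_le_natCast_iff n v).1 hv
  have hs : 0 < (v.1 : ℝ) ^ 2 + (v.2 : ℝ) ^ 2 + 1 := by positivity
  rw [logBarrier, ← Real.log_div (by positivity) hs.ne']
  refine (log_sq_le_mul_sqrt ?_).trans ?_
  · rw [one_le_div hs]
    nlinarith
  have hle : (2 * (n : ℝ) ^ 2 + 3) / ((v.1 : ℝ) ^ 2 + (v.2 : ℝ) ^ 2 + 1) ≤
      (4 * n) ^ 2 * (1 / ((|(v.1 : ℝ)| + 1) * (|(v.2 : ℝ)| + 1))) := by
    rw [mul_one_div, div_le_div_iff₀ hs (by positivity), ← sq_abs (v.1 : ℝ), ← sq_abs (v.2 : ℝ)]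
    have hx := abs_nonneg (v.1 : ℝ)
    have hy := abs_nonneg (v.2 : ℝ)
    generalize |(v.1 : ℝ)| = x at *
    generalize |(v.2 : ℝ)| = y at *
    have hxy : (x + 1) * (y + 1) ≤ 2 * (x ^ 2 + y ^ 2 + 1) := by
      nlinarith [sq_nonneg (x - y), sq_nonneg (x - 1), sq_nonneg (y - 1)]
    calc (2 * (n : ℝ) ^ 2 + 3) * ((x + 1) * (y + 1))
        ≤ (8 * (n : ℝ) ^ 2) * (2 * (x ^ 2 + y ^ 2 + 1)) := by
          gcongr
          nlinarith
      _ = (4 * n) ^ 2 * (x ^ 2 + y ^ 2 + 1) := by ring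
  calc 16 * √((2 * (n : ℝ) ^ 2 + 3) / ((v.1 : ℝ) ^ 2 + (v.2 : ℝ) ^ 2 + 1))
      ≤ 16 * √((4 * n) ^ 2 * (1 / ((|(v.1 : ℝ)| + 1) * (|(v.2 : ℝ)| + 1)))) := by gcongr
    _ = 64 * n * (1 / √(|(v.1 : ℝ)| + 1) * (1 / √(|(v.2 : ℝ)| + 1))) := by
      rw [Real.sqrt_mul (by positivity), Real.sqrt_sq (by positivity), Real.sqrt_div one_pos.le,
        Real.sqrt_mul (by positivity), Real.sqrt_one]
      field_simp
      ring

lemma sum_one_div_sqrt_abs_add_one_le (n : ℕ) :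
    ∑ k ∈ Finset.Icc (-(n : ℤ)) n, 1 / √(|(k : ℝ)| + 1) ≤ 4 * √((n : ℝ) + 1) := by
  induction n with
  | zero => norm_num
  | succ n ih =>
    have hIcc : Finset.Icc (-((n + 1 : ℕ) : ℤ)) ((n + 1 : ℕ) : ℤ) =
        insert ((n : ℤ) + 1) (insert (-((n : ℤ) + 1)) (Finset.Icc (-(n : ℤ)) n)) := by
      ext k
      simp only [Finset.mem_Icc, Finset.mem_insert]
      push_cast
      omega
    rw [hIcc, Finset.sum_insert (by simp; omega), Finset.sum_insert (by simp)]
    push_cast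
    rw [abs_neg, abs_of_nonneg (by positivity)]
    have ha : 0 ≤ √((n : ℝ) + 1) := Real.sqrt_nonneg _
    have hb : 0 < √((n : ℝ) + 1 + 1) := by positivity
    have ha2 : √((n : ℝ) + 1) ^ 2 = (n : ℝ) + 1 := Real.sq_sqrt (by positivity)
    have hb2 : √((n : ℝ) + 1 + 1) ^ 2 = (n : ℝ) + 1 + 1 := Real.sq_sqrt (by positivity)
    have hstep : 1 / √((n : ℝ) + 1 + 1) ≤ 2 * √((n : ℝ) + 1 + 1) - 2 * √((n : ℝ) + 1) := by
      rw [div_le_iff₀ hb]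
      nlinarith [sq_nonneg (√((n : ℝ) + 1 + 1) - √((n : ℝ) + 1))]
    linarith

/-- `L²` bound on Green functions of balls. -/
theorem green_l2_bound :
    ∃ C : ℝ, 0 < C ∧ ∀ n : ℕ, 0 < n → ∀ G : ℤ × ℤ → ℝ, IsGreen n G →
      ∑' v : ℤ × ℤ, (G v) ^ 2 ≤ C * (n : ℝ) ^ 2 := by
  refine ⟨2048, by norm_num, fun n hn G hG => ?_⟩
  have hn' : (1 : ℝ) ≤ n := by exact_mod_cast hn
  have hsupp : ∀ v ∉ intBox n, G v ^ 2 = 0 := fun v hv => by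
    rw [hG.1 v (not_le.1 fun h => hv (mem_intBox_of_znorm_le h)), sq, zero_mul]
  rw [tsum_eq_sum hsupp]
  have hpoint : ∀ v ∈ intBox n, G v ^ 2 ≤
      64 * n * (1 / √(|(v.1 : ℝ)| + 1) * (1 / √(|(v.2 : ℝ)| + 1))) := fun v _ => by
    by_cases hv : znorm v ≤ n
    · exact (hG.sq_le_logBarrier_sq hv).trans (logBarrier_sq_le hn hv)
    · rw [hG.1 v (not_le.1 hv), sq, zero_mul]
      positivity
  calc ∑ v ∈ intBox n, G v ^ 2
      ≤ ∑ v ∈ intBox n, 64 * n * (1 / √(|(v.1 : ℝ)| + 1) * (1 / √(|(v.2 : ℝ)| + 1))) :=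
        Finset.sum_le_sum hpoint
    _ = 64 * n * (∑ k ∈ Finset.Icc (-(n : ℤ)) n, 1 / √(|(k : ℝ)| + 1)) ^ 2 := by
        rw [← Finset.mul_sum, intBox, Finset.sum_product, sq, Finset.sum_mul_sum]
    _ ≤ 64 * n * (4 * √((n : ℝ) + 1)) ^ 2 := by
        gcongr
        exact sum_one_div_sqrt_abs_add_one_le n
    _ = 1024 * n * (n + 1) := by
        rw [mul_pow, Real.sq_sqrt (by positivity)]
        ring
    _ ≤ 2048 * (n : ℝ) ^ 2 := by nlinarith
end
end
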